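/- Let q be an odd prime power, h an even positive integer with (q−1)/h = 2τ+1 for some integer τ ≥ 1, let r be an odd integer with h < r < 2h, set n = r(q^2−1)/(2h) + 1, and let k be an integer with 1 ≤ k and 2hk ≤ r(q−1) + h. Then there exist pairwise distinct elements a_1,…,a_n of F_{q^2} and nonzero elements v_1,…,v_n of F_{q^2} such that Σ_{l=1}^n v_l^{q+1} a_l^{q·i+j} = 0 for all integers 0 ≤ i, j ≤ k−1 (with the convention 0^0 = 1); that is, the generalized Reed–Solomon code GRS_k(a,v) is a Hermitian self-orthogonal [n, k, n−k+1] MDS code over F_{q^2}, which by the Hermitian construction yields an [[n, n−2k, k+1]]_q quantum MDS code. -/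

import Mathlib

open Finset

/-- Weights on distinct nonzero nodes whose first `M - 1` positive power sums vanish. -/
lemma exists_weights_of_moments_zero {F : Type*} [Field F] (K : Subfield F) {M : ℕ} (hM : 0 < M)
    (x : Fin M → F) (hx : Function.Injective x) (hx0 : ∀ b, x b ≠ 0) (hxK : ∀ b, x b ∈ K) :
    ∃ w : Fin M → F, (∀ b, w b ≠ 0) ∧ (∀ b, w b ∈ K) ∧ ∑ b, w b ≠ 0 ∧
      ∀ t, 0 < t → t < M → ∑ b, w b * x b ^ t = 0 := by
  have hinj : Set.InjOn x (univ : Finset (Fin M)) := hx.injOn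
  have h0 : ∀ i ∈ (univ : Finset (Fin M)), (0 : F) ≠ x i := fun i _ => (hx0 i).symm
  refine ⟨fun b => Lagrange.nodalWeight univ x b * (0 - x b)⁻¹, fun b => ?_, fun b => ?_, ?_, ?_⟩
  · exact mul_ne_zero (Lagrange.nodalWeight_ne_zero hinj (mem_univ b))
      (inv_ne_zero (sub_ne_zero.mpr (hx0 b).symm))
  · exact K.mul_mem (K.prod_mem fun j _ => K.inv_mem (K.sub_mem (hxK b) (hxK j)))
      (K.inv_mem (K.sub_mem K.zero_mem (hxK b)))
  · have : NeZero M := ⟨hM.ne'⟩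
    exact Lagrange.sum_nodalWeight_mul_inv_sub_ne_zero hinj h0 univ_nonempty
  · intro t ht htM
    have key := Lagrange.eval_interpolate_not_at_node (fun b => x b ^ t) h0
    have hdeg : ((Polynomial.X : Polynomial F) ^ t).degree < #(univ : Finset (Fin M)) := by
      simpa using htM
    rw [← Lagrange.eq_interpolate_of_eval_eq (f := (Polynomial.X : Polynomial F) ^ t) _ hinj hdeg
      (by simp)] at key
    have hn : Polynomial.eval 0 (Lagrange.nodal univ x) ≠ 0 := by
      rw [Lagrange.eval_nodal]
      exact prod_ne_zero_iff.mpr fun i hi => sub_ne_zero.mpr (h0 i hi)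
    simpa [ht.ne', hn] using key.symm

lemma IsPrimitiveRoot.sum_pow_mul {F : Type*} [Field F] {ζ : F} {N : ℕ}
    (hζ : IsPrimitiveRoot ζ N) (e : ℕ) :
    ∑ i : Fin N, ζ ^ (i.val * e) = if N ∣ e then (N : F) else 0 := by
  rw [Fin.sum_univ_eq_sum_range (fun i => ζ ^ (i * e)) N]
  simp_rw [mul_comm _ e, pow_mul]
  split_ifs with h
  · simp [(hζ.pow_eq_one_iff_dvd e).mpr h]
  · have h1 : ζ ^ e ≠ 1 := fun h' => h ((hζ.pow_eq_one_iff_dvd e).mp h')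
    rw [geom_sum_eq h1, ← pow_mul, mul_comm, pow_mul, hζ.pow_eq_one]
    simp

/-- Inversion of the discrete Fourier transform. -/
lemma IsPrimitiveRoot.sum_dft_inv {F : Type*} [Field F] {ζ : F} {h : ℕ}
    (hζ : IsPrimitiveRoot ζ h) (hh : (h : F) ≠ 0) (P : ℕ → F) {t : ℕ} (ht : t < h) :
    ∑ b : Fin h, ((h : F)⁻¹ * ∑ s ∈ range h, P s * ζ⁻¹ ^ (b.val * s)) * ζ ^ (b.val * t) = P t := by
  have hζ0 : ζ ≠ 0 := hζ.ne_zero (by omega)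
  have key : ∀ s ∈ range h, ∑ b : Fin h, ζ⁻¹ ^ (b.val * s) * ζ ^ (b.val * t)
      = if s = t then (h : F) else 0 := by
    intro s hs
    rw [mem_range] at hs
    have h1 : ∀ b : Fin h, ζ⁻¹ ^ (b.val * s) * ζ ^ (b.val * t) = ζ ^ (b.val * (h - s + t)) := by
      intro b
      rw [inv_pow, inv_mul_eq_iff_eq_mul₀ (pow_ne_zero _ hζ0), ← pow_add, ← mul_add,
        show s + (h - s + t) = h + t by omega, mul_add, pow_add, mul_comm _ h, pow_mul ζ h,
        hζ.pow_eq_one, one_pow, one_mul]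
    rw [sum_congr rfl fun b _ => h1 b, hζ.sum_pow_mul]
    refine if_congr ⟨?_, ?_⟩ rfl rfl
    · rintro ⟨c, hc⟩
      have hc1 : 0 < c := by
        rcases Nat.eq_zero_or_pos c with rfl | h
        · omega
        · exact h
      have hc2 : c < 2 := by
        by_contra! h2
        have := Nat.mul_le_mul_left h h2
        omega
      obtain rfl : c = 1 := by omega
      omega
    · rintro rfl
      exact ⟨1, by omega⟩
  calc _ = ∑ s ∈ range h, (h : F)⁻¹ * P s *
        ∑ b : Fin h, ζ⁻¹ ^ (b.val * s) * ζ ^ (b.val * t) := by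
        simp_rw [mul_sum, sum_mul]
        rw [sum_comm]
        exact sum_congr rfl fun s _ => sum_congr rfl fun b _ => by ring
    _ = P t := by
        rw [sum_congr rfl fun s hs => by rw [key s hs]]
        simp [ht]
        field_simp

/-- A linear perturbation along nonzero directions avoids zero on `h` coordinates. -/
lemma exists_forall_add_mul_ne_zero {F : Type*} [Field F] (K : Subfield F) {h : ℕ}
    (S : Finset F) (hS : h < #S) (hSK : ∀ c ∈ S, c ∈ K)
    (A B : Fin h → F) (hB : ∀ b, B b ≠ 0) :
    ∃ c ∈ K, ∀ b, A b + c * B b ≠ 0 := by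
  classical
  have : ∃ c ∈ S, c ∉ univ.image fun b => -A b / B b := by
    refine exists_mem_notMem_of_card_lt_card (lt_of_le_of_lt card_image_le ?_)
    simpa using hS
  obtain ⟨c, hc, hc'⟩ := this
  refine ⟨c, hSK c hc, fun b hb => hc' (mem_image.mpr ⟨b, mem_univ b, ?_⟩)⟩
  rw [div_eq_iff (hB b)]
  linear_combination -hb

/-- Weights on the even powers of `ξ` and on the first `M` odd powers of `ξ`, lying in a subfield
containing `ξ ^ 2`, whose power sums cancel in the indicated range. -/
lemma exists_weights_of_primitiveRoot {F : Type*} [Field F] (K : Subfield F) {h M : ℕ}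
    (h2 : (2 : F) ≠ 0) (hhF : (h : F) ≠ 0) (hhe : Even h) (hM : 0 < M) (hMh : M < h)
    {ξ : F} (hξ : IsPrimitiveRoot ξ (2 * h)) (hξK : ξ ^ 2 ∈ K) :
    ∃ (u : Fin h → F) (w : Fin M → F), (∀ b, u b ≠ 0 ∧ u b ∈ K) ∧ (∀ b, w b ≠ 0 ∧ w b ∈ K) ∧
      (∑ b, u b + ∑ b, w b ≠ 0) ∧
      ∀ t, 0 < t → t < h + M → (M ≤ t → t ≤ h → Even t) →
        ∑ b, u b * ξ ^ (2 * b.val * t) + ∑ b, w b * ξ ^ ((2 * b.val + 1) * t) = 0 := by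
  classical
  have hh0 : 0 < h := by omega
  have hζ : IsPrimitiveRoot (ξ ^ 2) h := hξ.pow (by omega) rfl
  have hξ0 : ξ ≠ 0 := hξ.ne_zero (by omega)
  have hζ0 : ξ ^ 2 ≠ 0 := pow_ne_zero _ hξ0
  have hξh : ξ ^ h = -1 := by
    have h1 : ξ ^ h ≠ 1 := hξ.pow_ne_one_of_pos_of_lt hh0.ne' (by omega)
    have h3 : (ξ ^ h) ^ 2 = 1 := by rw [← pow_mul, mul_comm, hξ.pow_eq_one]
    exact (by simpa using h3 : ξ ^ h = 1 ∨ ξ ^ h = -1).resolve_left h1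
  obtain ⟨w, hw0, hwK, hws, hwt⟩ := exists_weights_of_moments_zero K hM
    (fun b : Fin M => (ξ ^ 2) ^ b.val)
    (fun a b hab => Fin.ext (hζ.pow_inj (by omega) (by omega) hab))
    (fun b => pow_ne_zero _ hζ0) (fun b => K.pow_mem hξK _)
  set V : ℕ → F := fun t => ∑ b, w b * ξ ^ ((2 * b.val + 1) * t) with hV
  have hV0 : V 0 = ∑ b, w b := by simp [hV]
  have hVshift : ∀ t, V (t + h) = -V t := by
    intro t
    simp only [hV]
    rw [← sum_neg_distrib]
    refine sum_congr rfl fun b _ => ?_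
    rw [mul_add, pow_add, mul_comm _ h, pow_mul ξ h, hξh, Odd.neg_one_pow ⟨b.val, rfl⟩]
    ring
  have hVz : ∀ t, 0 < t → t < M → V t = 0 := by
    intro t ht htM
    have : V t = ξ ^ t * ∑ b, w b * ((ξ ^ 2) ^ b.val) ^ t := by
      rw [mul_sum]
      exact sum_congr rfl fun b _ => by ring
    rw [this, hwt t ht htM, mul_zero]
  have hVK : ∀ t, Even t → V t ∈ K := by
    rintro t ⟨s, rfl⟩
    refine K.sum_mem fun b _ => K.mul_mem (hwK b) ?_
    rw [show (2 * b.val + 1) * (s + s) = 2 * ((2 * b.val + 1) * s) by ring, pow_mul]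
    exact K.pow_mem hξK _
  set P₀ : ℕ → F := fun t => if t = 0 then V 0 else if Even t then -V t else 0 with hP₀
  have hP₀K : ∀ t, P₀ t ∈ K := by
    intro t
    simp only [hP₀]
    split_ifs with h1 h2
    · exact hVK 0 (by simp)
    · exact K.neg_mem (hVK t h2)
    · exact K.zero_mem
  have hηK : (ξ ^ 2)⁻¹ ∈ K := K.inv_mem hξK
  obtain ⟨c, hcK, hc⟩ := exists_forall_add_mul_ne_zero K
    (insert 0 ((range h).image fun i => (ξ ^ 2) ^ i))
    (by
      rw [card_insert_of_notMem, card_image_of_injOn, card_range]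
      · exact Nat.lt_succ_self h
      · intro a ha b hb hab
        simp only [coe_range, Set.mem_Iio] at ha hb
        exact hζ.pow_inj ha hb hab
      · simp [hξ0])
    (by
      intro c hc
      rcases mem_insert.mp hc with rfl | hc
      · exact K.zero_mem
      · obtain ⟨i, -, rfl⟩ := mem_image.mp hc
        exact K.pow_mem hξK _)
    (fun b : Fin h => ∑ s ∈ range h, P₀ s * (ξ ^ 2)⁻¹ ^ (b.val * s))
    (fun b : Fin h => (ξ ^ 2)⁻¹ ^ (b.val * (h - 1)))
    (fun b => pow_ne_zero _ (inv_ne_zero hζ0))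
  set P : ℕ → F := fun t => P₀ t + if t = h - 1 then c else 0 with hP
  have hPK : ∀ t, P t ∈ K := by
    intro t
    refine K.add_mem (hP₀K t) ?_
    split_ifs
    exacts [hcK, K.zero_mem]
  set u : Fin h → F := fun b => (h : F)⁻¹ * ∑ s ∈ range h, P s * (ξ ^ 2)⁻¹ ^ (b.val * s) with hu
  set U : ℕ → F := fun t => ∑ b, u b * ξ ^ (2 * b.val * t) with hU
  have hUP : ∀ t, t < h → U t = P t := by
    intro t ht
    rw [← hζ.sum_dft_inv hhF P ht]
    exact sum_congr rfl fun b _ => by rw [← pow_mul, mul_assoc 2]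
  have hUshift : ∀ t, U (t + h) = U t := by
    intro t
    refine sum_congr rfl fun b _ => ?_
    rw [show 2 * b.val * (t + h) = 2 * b.val * t + 2 * h * b.val by ring, pow_add,
      pow_mul ξ (2 * h), hξ.pow_eq_one, one_pow, mul_one]
  have hPodd : ∀ t, 0 < t → t < h → t ≠ h - 1 → Odd t → P t = 0 := by
    intro t h1 _ h3 h4
    simp [hP, hP₀, h1.ne', h3, Nat.not_even_iff_odd.mpr h4]
  have hh1 : ¬ Even (h - 1) := by
    obtain ⟨a, rfl⟩ := hhe
    rintro ⟨b, hb⟩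
    omega
  have hPeven : ∀ t, 0 < t → t < h → Even t → P t = -V t := by
    intro t h1 _ h4
    have h3 : t ≠ h - 1 := by
      rintro rfl
      exact hh1 h4
    simp [hP, hP₀, h1.ne', h3, h4]
  have hP0 : P 0 = V 0 := by
    have : (0 : ℕ) ≠ h - 1 := by omega
    simp [hP, hP₀, this]
  have hlow : ∀ t, 0 < t → t < M → U t = 0 := by
    intro t h1 h3
    rw [hUP t (by omega)]
    rcases Nat.even_or_odd t with he | ho
    · rw [hPeven t h1 (by omega) he, hVz t h1 h3, neg_zero]
    · exact hPodd t h1 (by omega) (by omega) ho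
  refine ⟨u, w, fun b => ⟨?_, ?_⟩, fun b => ⟨hw0 b, hwK b⟩, ?_, ?_⟩
  · refine mul_ne_zero (inv_ne_zero hhF) ?_
    convert! hc b using 1
    simp only [hP, add_mul, sum_add_distrib, ite_mul, zero_mul]
    rw [sum_ite_eq' (range h) (h - 1)]
    simp [hh0]
  · exact K.mul_mem (K.inv_mem (natCast_mem K h))
      (K.sum_mem fun s _ => K.mul_mem (hPK s) (K.pow_mem hηK _))
  · have h3 : ∑ b, u b = U 0 := by simp [hU]
    rw [h3, hUP 0 hh0, hP0, hV0, ← two_mul]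
    exact mul_ne_zero h2 hws
  · intro t h1 h3 h4
    change U t + V t = 0
    rcases lt_or_ge t M with h5 | h5
    · rw [hlow t h1 h5, hVz t h1 h5, add_zero]
    rcases lt_trichotomy t h with h6 | rfl | h6
    · rw [hUP t h6, hPeven t h1 h6 (h4 h5 h6.le), neg_add_cancel]
    · have h7 := hUshift 0
      have h8 := hVshift 0
      rw [zero_add] at h7 h8
      rw [h7, h8, hUP 0 hh0, hP0, add_neg_cancel]
    · obtain ⟨s, rfl⟩ := Nat.exists_eq_add_of_le' h6.le
      rw [hUshift, hVshift, hlow s (by omega) (by omega), hVz s (by omega) (by omega)]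
      simp

/-- Weights on cosets of the subgroup generated by `g ^ L`, extended to the point `0`: power sums
reduce to power sums of the coset representatives. -/
lemma sum_coset_weights_eq_zero {F κ : Type*} [Field F] [Fintype κ] {g : F} {L N : ℕ}
    (hL : 0 < L) (hN : 0 < N) (hg : IsPrimitiveRoot g (L * N)) (ε : κ → ℕ) (W : κ → F) (e : ℕ)
    (he : ∀ t, 0 < t → e = N * t → ∑ x, W x * (g ^ N) ^ (ε x * t) = 0) :
    ∑ l : Option (κ × Fin N), (l.elim (-(N * ∑ x, W x)) fun p => W p.1) *
      (l.elim 0 fun p => g ^ (ε p.1 + L * p.2.val)) ^ e = 0 := by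
  have hω : IsPrimitiveRoot (g ^ L) N := hg.pow (by positivity) rfl
  have hsum : ∑ p : κ × Fin N, W p.1 * (g ^ (ε p.1 + L * p.2.val)) ^ e
      = (∑ x, W x * g ^ (ε x * e)) * if N ∣ e then (N : F) else 0 := by
    rw [← hω.sum_pow_mul e, Fintype.sum_prod_type, sum_mul_sum]
    exact sum_congr rfl fun x _ => sum_congr rfl fun i _ => by ring
  rw [Fintype.sum_option]
  simp only [Option.elim_none, Option.elim_some]
  rw [hsum]
  rcases Nat.eq_zero_or_pos e with rfl | he0
  · simp
    ring
  · rw [zero_pow he0.ne', mul_zero, zero_add]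
    split_ifs with hdvd
    · obtain ⟨t, rfl⟩ := hdvd
      have ht : 0 < t := Nat.pos_of_mul_pos_left he0
      have := he t ht rfl
      rw [← zero_mul (N : F), ← this]
      congr 1
      exact sum_congr rfl fun x _ => by ring
    · simp

lemma coset_points_injective {F κ : Type*} [Field F] {g : F} {L N : ℕ}
    (hL : 0 < L) (hN : 0 < N) (hg : IsPrimitiveRoot g (L * N)) (ε : κ → ℕ)
    (hε : Function.Injective ε) (hεL : ∀ x, ε x < L) :
    Function.Injective fun l : Option (κ × Fin N) =>
      l.elim (0 : F) fun p => g ^ (ε p.1 + L * p.2.val) := by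
  have hg0 : g ≠ 0 := hg.ne_zero (by positivity)
  have hlt : ∀ (x : κ) (i : Fin N), ε x + L * i.val < L * N := by
    intro x i
    have h1 := hεL x
    have h2 : L * (i.val + 1) ≤ L * N := Nat.mul_le_mul_left L i.isLt
    rw [mul_add] at h2
    omega
  rintro (_ | ⟨x, i⟩) (_ | ⟨y, j⟩) hab
  · rfl
  · exact absurd hab.symm (pow_ne_zero _ hg0)
  · exact absurd hab (pow_ne_zero _ hg0)
  · have h1 := hg.pow_inj (hlt x i) (hlt y j) hab
    have h2 := congrArg (· % L) h1
    have h3 := congrArg (· / L) h1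
    simp only [Nat.add_mul_mod_self_left, Nat.mod_eq_of_lt (hεL _)] at h2
    simp only [Nat.add_mul_div_left _ _ hL, Nat.div_eq_of_lt (hεL _), zero_add] at h3
    rw [hε h2, Fin.ext h3]

/-- The exponents `q * i + j` divisible by `m * Q`, where `q + 1 = 2 * Q`. -/
lemma multiplier_of_exponent {q h m M Q k i j t : ℕ} (hqm : q = h * m + 1) (hQ : q + 1 = 2 * Q)
    (hm : Odd m) (hk : 2 * k ≤ (h + M) * m + 1) (hi : i < k) (hj : j < k)
    (he : q * i + j = m * Q * t) :
    t < h + M ∧ (M ≤ t → t ≤ h → Even t) := by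
  have hm0 : 0 < m := hm.pos
  have hi2 : 2 * i + 1 ≤ (h + M) * m := by omega
  have hj2 : 2 * j + 1 ≤ (h + M) * m := by omega
  have he2 : q * (2 * i) + 2 * j = t * m * (q + 1) := by
    rw [hQ]
    linear_combination 2 * he
  refine ⟨?_, fun h1 h2 => ?_⟩
  · by_contra! h3
    have h4 : (h + M) * m ≤ t * m := Nat.mul_le_mul_right m h3
    nlinarith [Nat.zero_le q]
  · by_contra! h3
    obtain ⟨s, hs⟩ := (Nat.not_even_iff_odd.mp h3).mul hm
    have h5 : t * m ≤ h * m := Nat.mul_le_mul_right m h2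
    have h6 : M * m ≤ t * m := Nat.mul_le_mul_right m h1
    rw [add_mul] at hi2 hj2
    rcases Nat.lt_or_ge s i with h7 | h7
    · have h8 : q * (t * m + 1) ≤ q * (2 * i) := Nat.mul_le_mul_left q (by omega)
      nlinarith
    · have h8 : q * (2 * i + 1) ≤ q * (t * m) := Nat.mul_le_mul_left q (by omega)
      nlinarith

lemma FiniteField.exists_isPrimitiveRoot (F : Type*) [Field F] [Fintype F] :
    ∃ g : F, IsPrimitiveRoot g (Fintype.card F - 1) := by
  classical
  obtain ⟨g, hg⟩ := IsCyclic.exists_generator (α := Fˣ)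
  refine ⟨g, IsPrimitiveRoot.coe_units_iff.mpr ?_⟩
  rw [← Fintype.card_units, ← Nat.card_eq_fintype_card, ← orderOf_eq_card_of_forall_mem_zpowers hg]
  exact IsPrimitiveRoot.orderOf g

/-- The subfield of `q` elements of a field of `q ^ 2` elements. -/
lemma FiniteField.exists_subfield_pow_eq {F : Type*} [Field F] [Fintype F] {q : ℕ}
    (hq : IsPrimePow q) (hF : Fintype.card F = q ^ 2) :
    ∃ K : Subfield F, ∀ x, x ∈ K ↔ x ^ q = x := by
  obtain ⟨p, f, hp, hf, rfl⟩ := hq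
  have hp' : p.Prime := hp.nat_prime
  obtain ⟨p', hc, e, hp'', hcard⟩ := FiniteField.card' (K := F)
  have hdvd : p ∣ p' := by
    refine hp'.dvd_of_dvd_pow (n := e) ?_
    rw [← hcard, hF]
    exact dvd_pow (dvd_pow_self p hf.ne') two_ne_zero
  obtain rfl := (Nat.prime_dvd_prime_iff_eq hp' hp'').mp hdvd
  have : Fact p.Prime := ⟨hp'⟩
  exact ⟨(iterateFrobenius F p f).eqLocusField (RingHom.id F), fun x => by
    simp [RingHom.mem_eqLocusField, iterateFrobenius_def]⟩

/-- Surjectivity of the norm from a field of `q ^ 2` elements to its subfield of `q` elements. -/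
lemma FiniteField.exists_pow_succ_eq {F : Type*} [Field F] [Fintype F] {q : ℕ} (hq : 1 < q)
    (hF : Fintype.card F = q ^ 2) {x : F} (hx0 : x ≠ 0) (hx : x ^ q = x) :
    ∃ v : F, v ≠ 0 ∧ v ^ (q + 1) = x := by
  obtain ⟨g, hg⟩ := FiniteField.exists_isPrimitiveRoot F
  have hcard : Fintype.card F - 1 = (q + 1) * (q - 1) := by
    rw [hF]
    exact Nat.sq_sub_sq q 1
  have hq1 : 0 < q - 1 := by omega
  rw [hcard] at hg
  have hx1 : x ^ (q - 1) = 1 := by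
    refine mul_right_cancel₀ hx0 ?_
    rw [← pow_succ, Nat.sub_add_cancel hq.le, hx, one_mul]
  have : NeZero ((q + 1) * (q - 1)) := ⟨by positivity⟩
  obtain ⟨e, -, rfl⟩ := hg.eq_pow_of_pow_eq_one
    (show x ^ ((q + 1) * (q - 1)) = 1 by rw [mul_comm, pow_mul, hx1, one_pow])
  rw [← pow_mul, hg.pow_eq_one_iff_dvd] at hx1
  obtain ⟨d, rfl⟩ := Nat.dvd_of_mul_dvd_mul_right hq1 hx1
  exact ⟨g ^ d, pow_ne_zero _ (hg.ne_zero (NeZero.ne _)), by rw [← pow_mul, mul_comm]⟩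

theorem thm_qminus_len_plus_one_case2
    (q h τ r n : ℕ) (hq : IsPrimePow q) (hqo : Odd q)
    (hh : 0 < h) (hhe : Even h) (hτ : 1 ≤ τ)
    (hdiv : q - 1 = h * (2 * τ + 1))
    (hro : Odd r) (hr1 : h < r) (hr2 : r < 2 * h)
    -- n = r(q²-1)/(2h) + 1
    (hn : 2 * h * n = r * (q ^ 2 - 1) + 2 * h)
    (k : ℕ) (hk1 : 1 ≤ k)
    -- k ≤ r(q-1)/(2h) + 1/2
    (hk : 2 * h * k ≤ r * (q - 1) + h)
    (F : Type*) [Field F] [Fintype F] (hF : Fintype.card F = q ^ 2) :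
    ∃ a v : Fin n → F, Function.Injective a ∧ (∀ l, v l ≠ 0) ∧
      ∀ i j : ℕ, i < k → j < k →
        ∑ l, v l ^ (q + 1) * a l ^ (q * i + j) = 0 := by
  obtain ⟨Q, hQ⟩ : ∃ Q, q + 1 = 2 * Q := (hqo.add_one).two_dvd
  obtain ⟨M, rfl⟩ := Nat.exists_eq_add_of_le hr1.le
  set m := 2 * τ + 1 with hm
  have hm0 : 0 < m := by omega
  have hq1 : 1 < q := hq.one_lt
  have hqm : q = h * m + 1 := by omega
  set N := m * Q with hN
  have hN0 : 0 < N := Nat.mul_pos hm0 (by omega)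
  have hcard : q ^ 2 - 1 = 2 * h * N := by
    rw [show q ^ 2 - 1 = (q + 1) * (q - 1) from Nat.sq_sub_sq q 1, hdiv, hQ, hN]
    ring
  have hn' : n = (h + M) * N + 1 := by
    rw [hcard] at hn
    refine Nat.eq_of_mul_eq_mul_left (show 0 < 2 * h by omega) ?_
    rw [hn]
    ring
  have hk' : 2 * k ≤ (h + M) * m + 1 := by
    rw [hdiv] at hk
    refine Nat.le_of_mul_le_mul_left (c := h) ?_ hh
    linarith
  have hF0 : ((2 * h * N : ℕ) : F) ≠ 0 := by
    have h1 : ((q ^ 2 : ℕ) : F) = 0 := by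
      rw [← hF]
      exact FiniteField.cast_card_eq_zero F
    rw [← hcard, Nat.cast_sub (Nat.one_le_pow _ _ (by omega)), h1]
    simp
  push_cast at hF0
  have hN0F : (N : F) ≠ 0 := right_ne_zero_of_mul hF0
  have h2F : (2 : F) ≠ 0 := left_ne_zero_of_mul (left_ne_zero_of_mul hF0)
  have hhF : (h : F) ≠ 0 := right_ne_zero_of_mul (left_ne_zero_of_mul hF0)
  obtain ⟨K, hK⟩ := FiniteField.exists_subfield_pow_eq hq hF
  obtain ⟨g, hg⟩ := FiniteField.exists_isPrimitiveRoot F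
  rw [hF, hcard] at hg
  have hξ : IsPrimitiveRoot (g ^ N) (2 * h) := hg.pow (by positivity) (mul_comm _ _)
  have hξK : (g ^ N) ^ 2 ∈ K := by
    rw [hK, ← pow_mul, ← pow_mul, show N * (2 * q) = 2 * h * N * m + N * 2 by
      rw [hqm]
      ring]
    rw [pow_add, pow_mul, hg.pow_eq_one, one_pow, one_mul, pow_mul]
  obtain ⟨u, w, hu, hw, hsum, hpow⟩ := exists_weights_of_primitiveRoot K h2F hhF hhe
    (show 0 < M by omega) (by omega) hξ hξK
  let ε : Fin h ⊕ Fin M → ℕ := Sum.elim (fun b => 2 * b.val) fun b => 2 * b.val + 1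
  let W : Fin h ⊕ Fin M → F := Sum.elim u w
  have hε : Function.Injective ε := by
    rintro (a | a) (b | b) hab <;> simp only [ε, Sum.elim_inl, Sum.elim_inr] at hab
    · exact congrArg _ (Fin.ext (by omega))
    · omega
    · omega
    · exact congrArg _ (Fin.ext (by omega))
  have hεL : ∀ x, ε x < 2 * h := by
    rintro (a | a) <;> simp only [ε, Sum.elim_inl, Sum.elim_inr] <;> omega
  have hW : ∀ x, W x ≠ 0 ∧ W x ∈ K := by
    rintro (b | b)
    exacts [hu b, hw b]
  have hWs : ∑ x, W x ≠ 0 := by simpa [W] using hsum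
  let c : Option ((Fin h ⊕ Fin M) × Fin N) → F :=
    fun l => l.elim (-(N * ∑ x, W x)) fun p => W p.1
  have hc : ∀ l, c l ≠ 0 ∧ c l ∈ K := by
    rintro (_ | ⟨x, i⟩)
    · exact ⟨neg_ne_zero.mpr (mul_ne_zero hN0F hWs),
        K.neg_mem (K.mul_mem (natCast_mem K N) (K.sum_mem fun x _ => (hW x).2))⟩
    · exact hW x
  choose v hv0 hv using fun l =>
    FiniteField.exists_pow_succ_eq hq1 hF (hc l).1 ((hK _).mp (hc l).2)
  let φ : Fin n ≃ Option ((Fin h ⊕ Fin M) × Fin N) :=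
    Fintype.equivOfCardEq (by simp [hn'])
  refine ⟨fun l => (φ l).elim 0 fun p => g ^ (ε p.1 + 2 * h * p.2.val), v ∘ φ,
    (coset_points_injective (by omega) hN0 hg ε hε hεL).comp φ.injective, fun l => hv0 _, ?_⟩
  intro i j hi hj
  refine Eq.trans ?_ (sum_coset_weights_eq_zero (by omega) hN0 hg ε W (q * i + j) ?_)
  · rw [← φ.sum_comp]
    exact sum_congr rfl fun l _ => by rw [Function.comp_apply, hv]
  · intro t ht he
    obtain ⟨h1, h3⟩ := multiplier_of_exponent hqm hQ ⟨τ, rfl⟩ hk' hi hj he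
    simpa [W, ε] using hpow t ht h1 h3
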